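/- Let p and n be integers with p ≤ n ≤ 2p−5 and set φ := n − p. For every integer z with 1 ≤ z < 2φ and every integer y ≥ 0, the element G_{n−1}^y · G_{2φ−z} · G_{n−1}^{−y} lies in the subgroup L_{2φ + y − ⌊z/2⌋} of H_n. -/

import Mathlib

/-- Right-angled Artin relations on `N` generators (indexed `0, …, N-1`, standing for
`h_1, …, h_N`): commutators of generators whose indices differ by more than one. -/
def RaagRels (N : ℕ) : Set (FreeGroup (Fin N)) :=
  {rel | ∃ i j : Fin N, (i : ℕ) + 1 < (j : ℕ) ∧
    rel = FreeGroup.of i * FreeGroup.of j * (FreeGroup.of i)⁻¹ * (FreeGroup.of j)⁻¹}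

/-- The right-angled Artin group `H_n` on generators `h_1, …, h_{n-1}` subject to
`h_i h_j = h_j h_i` whenever `|i - j| > 1`. -/
abbrev Hgrp (n : ℕ) := PresentedGroup (RaagRels (n - 1))

/-- The generator `h_i` of `H_n`, for `1 ≤ i ≤ n-1` (and `1` for out-of-range indices). -/
def hgen (n : ℕ) (i : ℕ) : Hgrp n :=
  if h : 1 ≤ i ∧ i ≤ n - 1 then PresentedGroup.of (⟨i - 1, by omega⟩ : Fin (n - 1)) else 1

/-- `A(a,b) := h_a h_{a+1} ⋯ h_b` (the identity when `a > b`). -/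
def Aprod (n a b : ℕ) : Hgrp n := ((List.range' a (b + 1 - a) 1).map (hgen n)).prod

/-- `E(a,b) := h_a h_{a+2} ⋯ h_b` for even `a, b` (the identity when `a > b`). -/
def Eprod (n a b : ℕ) : Hgrp n := ((List.range' a ((b + 2 - a) / 2) 2).map (hgen n)).prod

/-- `O(a,b) := h_a h_{a+2} ⋯ h_b` for odd `a, b` (the identity when `a > b`). -/
def Oprod (n a b : ℕ) : Hgrp n := ((List.range' a ((b + 2 - a) / 2) 2).map (hgen n)).prod

/-- The elements `G_i` of `H_n` (with `φ := n - p`): `G_1 := h_1`,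
`G_{2k} := O(3,2k-1)·E(2,2k)` and `G_{2k+1} := O(3,2k+1)·E(2,2k)` for `1 ≤ k ≤ φ`, and
`G_i := O(3,2φ+1)·E(2,2φ)·A(2φ+2,i)` for `2φ+2 ≤ i ≤ n-1`. -/
def Ggen (n p i : ℕ) : Hgrp n :=
  if i = 1 then hgen n 1
  else if i ≤ 2 * (n - p) + 1 then
    if i % 2 = 0 then Oprod n 3 (i - 1) * Eprod n 2 i
    else Oprod n 3 i * Eprod n 2 (i - 1)
  else Oprod n 3 (2 * (n - p) + 1) * Eprod n 2 (2 * (n - p)) * Aprod n (2 * (n - p) + 2) i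

/-- `L_m`: the subgroup of `H_n` generated by the `h_i` with `1 ≤ i ≤ min m (n-1)`. -/
def Lsub (n m : ℕ) : Subgroup (Hgrp n) :=
  Subgroup.closure {x | ∃ i : ℕ, 1 ≤ i ∧ i ≤ min m (n - 1) ∧ x = hgen n i}

/-- `U_m`: the subgroup of `H_n` generated by the `h_i` with `max m 1 ≤ i ≤ n-1`. -/
def Usub (n m : ℕ) : Subgroup (Hgrp n) :=
  Subgroup.closure {x | ∃ i : ℕ, max m 1 ≤ i ∧ i ≤ n - 1 ∧ x = hgen n i}

theorem hgen_comm (n i j : ℕ) (hij : i + 1 < j) : Commute (hgen n i) (hgen n j) := by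
  unfold hgen
  split_ifs with h1 h2
  · have hr : FreeGroup.of (⟨i - 1, by omega⟩ : Fin (n - 1)) *
        FreeGroup.of (⟨j - 1, by omega⟩ : Fin (n - 1)) *
        (FreeGroup.of (⟨i - 1, by omega⟩ : Fin (n - 1)))⁻¹ *
        (FreeGroup.of (⟨j - 1, by omega⟩ : Fin (n - 1)))⁻¹ ∈ RaagRels (n - 1) :=
      ⟨⟨i - 1, by omega⟩, ⟨j - 1, by omega⟩, by simp only; omega, rfl⟩
    have h := PresentedGroup.one_of_mem hr
    simp only [map_mul, map_inv] at h
    rw [mul_inv_eq_one, mul_inv_eq_iff_eq_mul] at h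
    exact h
  · exact Commute.one_right _
  · exact Commute.one_left _
  · exact Commute.one_left _

theorem hgen_mem (n i m : ℕ) (h : i ≤ m) : hgen n i ∈ Lsub n m := by
  by_cases h1 : 1 ≤ i ∧ i ≤ n - 1
  · exact Subgroup.subset_closure ⟨i, h1.1, le_min h h1.2, rfl⟩
  · unfold hgen
    rw [dif_neg h1]
    exact one_mem _

theorem Lsub_mono (n a b : ℕ) (h : a ≤ b) : Lsub n a ≤ Lsub n b := by
  unfold Lsub
  rw [Subgroup.closure_le]
  rintro x ⟨i, h1, h2, rfl⟩
  exact hgen_mem n i b (by omega)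

theorem hgen_conj (n i m : ℕ) (hi : i ≠ m + 1) (x : Hgrp n) (hx : x ∈ Lsub n m) :
    hgen n i * x * (hgen n i)⁻¹ ∈ Lsub n m := by
  by_cases him : i ≤ m
  · exact mul_mem (mul_mem (hgen_mem n i m him) hx) (inv_mem (hgen_mem n i m him))
  · have hc : Lsub n m ≤ Subgroup.centralizer {hgen n i} := by
      unfold Lsub
      rw [Subgroup.closure_le]
      rintro x ⟨j, h1, h2, rfl⟩
      rw [SetLike.mem_coe, Subgroup.mem_centralizer_singleton_iff]
      exact (hgen_comm n j i (by omega)).eq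
    have h := Subgroup.mem_centralizer_singleton_iff.mp (hc hx)
    rw [← h, mul_inv_cancel_right]
    exact hx

theorem list_conj (n m : ℕ) (l : List ℕ) (hl : ∀ i ∈ l, i ≠ m + 1) (x : Hgrp n)
    (hx : x ∈ Lsub n m) :
    (l.map (hgen n)).prod * x * ((l.map (hgen n)).prod)⁻¹ ∈ Lsub n m := by
  induction l with
  | nil => simpa using hx
  | cons a l ih =>
    have h1 := ih (fun i hi => hl i (List.mem_cons_of_mem _ hi))
    have h2 := hgen_conj n a m (hl a List.mem_cons_self) _ h1
    simpa [mul_assoc] using h2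

theorem range_conj (n m k : ℕ) : ∀ (a : ℕ) (x : Hgrp n), x ∈ Lsub n m →
    ((List.range' a k 1).map (hgen n)).prod * x *
      (((List.range' a k 1).map (hgen n)).prod)⁻¹ ∈ Lsub n (m + 1) := by
  induction k with
  | zero => intro a x hx; simpa using Lsub_mono n m (m + 1) (by omega) hx
  | succ k ih =>
    intro a x hx
    by_cases ha : m + 2 ≤ a
    · apply Lsub_mono n m (m + 1) (by omega)
      apply list_conj _ _ _ _ _ hx
      intro i hi
      rw [List.mem_range'] at hi
      omega
    · have h2 := hgen_conj n a (m + 1) (by omega) _ (ih (a + 1) x hx)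
      simpa [List.range'_succ, mul_assoc] using h2

theorem list_mem (n m : ℕ) (l : List ℕ) (hl : ∀ i ∈ l, i ≤ m) :
    (l.map (hgen n)).prod ∈ Lsub n m := by
  apply Subgroup.list_prod_mem
  intro x hx
  rw [List.mem_map] at hx
  obtain ⟨i, hi, rfl⟩ := hx
  exact hgen_mem n i m (hl i hi)

theorem Ggen_mem (n p i : ℕ) (hi1 : 1 ≤ i) (hi : i ≤ 2 * (n - p) + 1) :
    Ggen n p i ∈ Lsub n i := by
  unfold Ggen Oprod Eprod
  split_ifs with h1 h2
  · exact hgen_mem _ _ _ (by omega)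
  all_goals
    apply mul_mem <;> apply list_mem <;> intro j hj <;> rw [List.mem_range'] at hj <;> omega

/-- The product form of `G_{n-1}`, and conjugation split into three steps. -/
theorem big_conj (n p a b c m : ℕ) (hn : 2 * (n - p) + 2 ≤ n - 1) (x : Hgrp n)
    (hA : Aprod n (2 * (n - p) + 2) (n - 1) * x * (Aprod n (2 * (n - p) + 2) (n - 1))⁻¹
      ∈ Lsub n a) (hab : a ≤ b) (hbc : b ≤ c) (hcm : c ≤ m)
    (hb : b % 2 = 0 ∨ 2 * (n - p) ≤ b) (hb0 : b % 2 = 0 ∨ 2 * (n - p) + 1 ≤ b)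
    (hc : c % 2 = 1 ∨ 2 * (n - p) + 1 ≤ c) :
    Ggen n p (n - 1) * x * (Ggen n p (n - 1))⁻¹ ∈ Lsub n m := by
  have hE := list_conj n b (List.range' 2 ((2 * (n - p) + 2 - 2) / 2) 2)
    (by intro i hi; rw [List.mem_range'] at hi; omega) _ (Lsub_mono n a b hab hA)
  have hO := list_conj n c (List.range' 3 ((2 * (n - p) + 1 + 2 - 3) / 2) 2)
    (by intro i hi; rw [List.mem_range'] at hi; omega) _ (Lsub_mono n b c hbc hE)
  have h := Lsub_mono n c m hcm hO
  have hG : Ggen n p (n - 1) = Oprod n 3 (2 * (n - p) + 1) * Eprod n 2 (2 * (n - p)) *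
      Aprod n (2 * (n - p) + 2) (n - 1) := by
    unfold Ggen
    rw [if_neg (by omega), if_neg (by omega)]
  rw [hG]
  simpa only [Oprod, Eprod, mul_assoc, mul_inv_rev] using h

theorem A_conj_low (n p m : ℕ) (hm : m ≤ 2 * (n - p)) (x : Hgrp n) (hx : x ∈ Lsub n m) :
    Aprod n (2 * (n - p) + 2) (n - 1) * x * (Aprod n (2 * (n - p) + 2) (n - 1))⁻¹
      ∈ Lsub n m := by
  apply list_conj _ _ _ _ _ hx
  intro i hi
  rw [List.mem_range'] at hi
  omega

theorem step_even (n p m : ℕ) (hn : 2 * (n - p) + 2 ≤ n - 1) (hm : m ≤ 2 * (n - p))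
    (he : m % 2 = 0) (x : Hgrp n) (hx : x ∈ Lsub n m) :
    Ggen n p (n - 1) * x * (Ggen n p (n - 1))⁻¹ ∈ Lsub n (m + 1) :=
  big_conj n p m m (m + 1) (m + 1) hn x (A_conj_low n p m hm x hx)
    (by omega) (by omega) (by omega) (by omega) (by omega) (by omega)

theorem step_odd (n p m : ℕ) (hn : 2 * (n - p) + 2 ≤ n - 1) (hm : m ≤ 2 * (n - p))
    (he : m % 2 = 1) (x : Hgrp n) (hx : x ∈ Lsub n m) :
    Ggen n p (n - 1) * x * (Ggen n p (n - 1))⁻¹ ∈ Lsub n (m + 2) :=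
  big_conj n p m (m + 1) (m + 2) (m + 2) hn x (A_conj_low n p m hm x hx)
    (by omega) (by omega) (by omega) (by omega) (by omega) (by omega)

theorem step_high (n p m : ℕ) (hn : 2 * (n - p) + 2 ≤ n - 1) (hm : 2 * (n - p) + 1 ≤ m)
    (x : Hgrp n) (hx : x ∈ Lsub n m) :
    Ggen n p (n - 1) * x * (Ggen n p (n - 1))⁻¹ ∈ Lsub n (m + 1) :=
  big_conj n p (m + 1) (m + 1) (m + 1) (m + 1) hn x (range_conj n m _ _ x hx)
    (by omega) (by omega) (by omega) (by omega) (by omega) (by omega)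

theorem pow_conj_succ {G : Type*} [Group G] (g x : G) (y : ℕ) :
    g ^ (y + 1) * x * (g ^ (y + 1))⁻¹ = g ^ y * (g * x * g⁻¹) * (g ^ y)⁻¹ := by
  rw [pow_succ, mul_inv_rev]
  simp only [mul_assoc]

theorem iter_high (n p : ℕ) (hn : 2 * (n - p) + 2 ≤ n - 1) (y : ℕ) :
    ∀ (m : ℕ), 2 * (n - p) + 1 ≤ m → ∀ x ∈ Lsub n m,
    Ggen n p (n - 1) ^ y * x * (Ggen n p (n - 1) ^ y)⁻¹ ∈ Lsub n (m + y) := by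
  induction y with
  | zero => intro m _ x hx; simpa using hx
  | succ y ih =>
    intro m hm x hx
    rw [pow_conj_succ]
    exact Lsub_mono n _ _ (by omega) (ih (m + 1) (by omega) _ (step_high n p m hn hm x hx))

theorem iter_odd (n p : ℕ) (hn : 2 * (n - p) + 2 ≤ n - 1) (w : ℕ) :
    ∀ (m : ℕ), m + 2 * w + 1 = 2 * (n - p) → ∀ x ∈ Lsub n m, ∀ y : ℕ,
    Ggen n p (n - 1) ^ y * x * (Ggen n p (n - 1) ^ y)⁻¹ ∈ Lsub n (2 * (n - p) + y - w) := by
  induction w with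
  | zero =>
    intro m hm x hx y
    cases y with
    | zero => simpa using Lsub_mono n _ _ (by omega) hx
    | succ y =>
      rw [pow_conj_succ]
      exact Lsub_mono n _ _ (by omega) (iter_high n p hn y (m + 2) (by omega) _
        (step_odd n p m hn (by omega) (by omega) x hx))
  | succ w ih =>
    intro m hm x hx y
    cases y with
    | zero =>
      rw [pow_zero, one_mul, inv_one, mul_one]
      exact Lsub_mono n _ _ (by omega) hx
    | succ y =>
      rw [pow_conj_succ]
      exact Lsub_mono n _ _ (by omega) (ih (m + 2) (by omega) _
        (step_odd n p m hn (by omega) (by omega) x hx) y)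

/-- Lemma 6.6, item 4 (generic form):  for `p ≤ n ≤ 2p - 5`, every `1 ≤ z < 2φ` and
every `y ≥ 0`, the element `G_{n-1}^y G_{2φ-z} G_{n-1}^{-y}` lies in the subgroup
`L_{2φ + y - ⌊z/2⌋}` of `H_n`. -/
theorem stmt_15 (p n : ℕ) (hpn : p ≤ n) (hn : n ≤ 2 * p - 5)
    (z y : ℕ) (hz1 : 1 ≤ z) (hz2 : z < 2 * (n - p)) :
    Ggen n p (n - 1) ^ y * Ggen n p (2 * (n - p) - z) * (Ggen n p (n - 1) ^ y)⁻¹ ∈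
      Lsub n (2 * (n - p) + y - z / 2) := by
  have hn' : 2 * (n - p) + 2 ≤ n - 1 := by omega
  have hx := Ggen_mem n p (2 * (n - p) - z) (by omega) (by omega)
  rcases Nat.even_or_odd' z with ⟨w, hw | hw⟩
  · cases y with
    | zero =>
      rw [pow_zero, one_mul, inv_one, mul_one]
      exact Lsub_mono n _ _ (by omega) hx
    | succ y =>
      rw [pow_conj_succ]
      exact Lsub_mono n _ _ (by omega) (iter_odd n p hn' (w - 1) (2 * (n - p) - z + 1)
        (by omega) _ (step_even n p _ hn' (by omega) (by omega) _ hx) y)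
  · exact Lsub_mono n _ _ (by omega) (iter_odd n p hn' w (2 * (n - p) - z) (by omega) _ hx y)
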